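/- Let d ≥ 1 and 1 ≤ k ≤ d. Let P be a k×d real matrix with P·Pᵀ = I_k and M := Pᵀ·P. Let Σ be a symmetric positive semidefinite d×d real matrix and let α_s, σ_s, σ_y be positive reals. Define D := α_s·Σ·(α_s²·Σ + σ_s²·I)⁻¹, R := I − α_s·D, K_dps := σ_y⁻²·Dᵀ·M·D, K_ding := α_s⁻²·σ_y⁻²·M, and for η > 0 set Σ_dps(η) := (η⁻²·I + K_dps)⁻¹ and Σ_ding(η) := A(η) + η²·α_s⁻⁴·σ_y⁻⁴·A(η)·M·R·Rᵀ·M·A(η), where A(η) := (η⁻²·I + K_ding)⁻¹. Then there exist a constant C > 0 and η₀ > 0 such that for all η with 0 < η < η₀, the matrices η⁻²·I + K_dps and η⁻²·I + K_ding are invertible and ‖Σ_dps(η) − Σ_ding(η)‖ ≤ C·η⁴. -/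

import Mathlib

open Matrix

/-- ℓ²→ℓ² operator norm of a real matrix. -/
noncomputable def opNorm {m n : ℕ} (A : Matrix (Fin m) (Fin n) ℝ) : ℝ :=
  ‖LinearMap.toContinuousLinearMap (Matrix.toEuclideanLin A)‖

section Perturbation

variable {E : Type*} [NormedRing E] [NormedAlgebra ℝ E]

/-- A large multiple of the identity plus a fixed element of a Banach algebra is invertible. -/
theorem isUnit_inv_smul_one_add [CompleteSpace E] {K : E} {t : ℝ} (ht : 0 < t)
    (hK : t * ‖K‖ ≤ 1 / 2) : IsUnit (t⁻¹ • (1 : E) + K) := by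
  have hnorm : ‖-(t • K)‖ < 1 := by
    rw [norm_neg, norm_smul, Real.norm_of_nonneg ht.le]
    linarith
  have h := (isUnit_one_sub_of_norm_lt_one hnorm).smul (Units.mk0 t⁻¹ (inv_ne_zero ht.ne'))
  rwa [Units.smul_mk0, sub_neg_eq_add, smul_add, smul_smul, inv_mul_cancel₀ ht.ne',
    one_smul] at h

/-- A left inverse of `t⁻¹ + K` equals `t` up to an error of order `t ^ 2`. -/
theorem norm_leftInverse_inv_smul_one_add {K B : E} {t : ℝ} (ht : 0 < t)
    (hK : t * ‖K‖ ≤ 1 / 2) (hB : B * (t⁻¹ • (1 : E) + K) = 1) :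
    ‖B‖ ≤ 2 * ‖(1 : E)‖ * t ∧ ‖B - t • (1 : E)‖ ≤ 2 * ‖(1 : E)‖ * ‖K‖ * t ^ 2 := by
  have hBK : B - t • (1 : E) = -(t • (B * K)) := by
    rw [← hB, mul_add, mul_smul_comm, mul_one, smul_add, smul_smul, mul_inv_cancel₀ ht.ne',
      one_smul]
    abel
  have hdiff : ‖B - t • (1 : E)‖ ≤ t * (‖B‖ * ‖K‖) := by
    rw [hBK, norm_neg, norm_smul, Real.norm_of_nonneg ht.le]
    gcongr
    exact norm_mul_le B K
  have hnorm : ‖B‖ ≤ 2 * ‖(1 : E)‖ * t := by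
    have h := norm_le_norm_add_norm_sub' B (t • (1 : E))
    rw [norm_smul, Real.norm_of_nonneg ht.le] at h
    nlinarith [mul_le_mul_of_nonneg_left hK (norm_nonneg B)]
  refine ⟨hnorm, hdiff.trans ?_⟩
  calc t * (‖B‖ * ‖K‖) ≤ t * ((2 * ‖(1 : E)‖ * t) * ‖K‖) := by gcongr
    _ = 2 * ‖(1 : E)‖ * ‖K‖ * t ^ 2 := by ring

end Perturbation

open scoped Matrix.Norms.L2Operator in
theorem opNorm_eq_norm {m n : ℕ} (X : Matrix (Fin m) (Fin n) ℝ) : opNorm X = ‖X‖ := rfl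

open scoped Matrix.Norms.L2Operator in
/-- The estimate behind the comparison of the two covariances, for arbitrary matrices. -/
theorem exists_opNorm_inv_sub_le {d : ℕ} (K L N : Matrix (Fin d) (Fin d) ℝ) {c : ℝ}
    (hc : 0 ≤ c) : ∃ C > (0 : ℝ), ∃ η₀ > (0 : ℝ), ∀ η : ℝ, 0 < η → η < η₀ →
      IsUnit ((η ^ 2)⁻¹ • (1 : Matrix (Fin d) (Fin d) ℝ) + K) ∧
      IsUnit ((η ^ 2)⁻¹ • (1 : Matrix (Fin d) (Fin d) ℝ) + L) ∧
      opNorm (((η ^ 2)⁻¹ • 1 + K)⁻¹ - (((η ^ 2)⁻¹ • 1 + L)⁻¹ +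
        (η ^ 2 * c) • (((η ^ 2)⁻¹ • 1 + L)⁻¹ * N * ((η ^ 2)⁻¹ • 1 + L)⁻¹))) ≤ C * η ^ 4 := by
  have : CompleteSpace (Matrix (Fin d) (Fin d) ℝ) := FiniteDimensional.complete ℝ _
  set e := ‖(1 : Matrix (Fin d) (Fin d) ℝ)‖
  have he : 0 ≤ e := norm_nonneg _
  refine ⟨2 * e * ‖K‖ + 2 * e * ‖L‖ + c * (4 * e ^ 2 * ‖N‖) + 1, by positivity,
    1 / (1 + 2 * (‖K‖ + ‖L‖)), by positivity, fun η hη hlt => ?_⟩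
  rw [lt_div_iff₀ (by positivity)] at hlt
  have hK0 := norm_nonneg K
  have hL0 := norm_nonneg L
  have hη1 : η ≤ 1 := by nlinarith [mul_nonneg hη.le hK0, mul_nonneg hη.le hL0]
  have ht : 0 < η ^ 2 := by positivity
  have hsq : η ^ 2 ≤ η := by nlinarith
  have hK : η ^ 2 * ‖K‖ ≤ 1 / 2 := by
    nlinarith [mul_le_mul_of_nonneg_right hsq hK0, mul_nonneg hη.le hL0]
  have hL : η ^ 2 * ‖L‖ ≤ 1 / 2 := by
    nlinarith [mul_le_mul_of_nonneg_right hsq hL0, mul_nonneg hη.le hK0]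
  have hKu := isUnit_inv_smul_one_add ht hK
  have hLu := isUnit_inv_smul_one_add ht hL
  refine ⟨hKu, hLu, ?_⟩
  obtain ⟨-, hB⟩ := norm_leftInverse_inv_smul_one_add ht hK
    (Matrix.nonsing_inv_mul _ ((Matrix.isUnit_iff_isUnit_det _).1 hKu))
  obtain ⟨hA, hA'⟩ := norm_leftInverse_inv_smul_one_add ht hL
    (Matrix.nonsing_inv_mul _ ((Matrix.isUnit_iff_isUnit_det _).1 hLu))
  rw [opNorm_eq_norm]
  set B := ((η ^ 2)⁻¹ • (1 : Matrix (Fin d) (Fin d) ℝ) + K)⁻¹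
  set A := ((η ^ 2)⁻¹ • (1 : Matrix (Fin d) (Fin d) ℝ) + L)⁻¹
  have hANA : ‖(η ^ 2 * c) • (A * N * A)‖ ≤ c * (4 * e ^ 2 * ‖N‖) * η ^ 4 := by
    rw [norm_smul, Real.norm_of_nonneg (by positivity)]
    calc η ^ 2 * c * ‖A * N * A‖ ≤ η ^ 2 * c * (‖A‖ * ‖N‖ * ‖A‖) := by
          gcongr
          exact norm_mul₃_le
      _ ≤ 1 * c * ((2 * e * η ^ 2) * ‖N‖ * (2 * e * η ^ 2)) := by
          gcongr
          linarith
      _ = c * (4 * e ^ 2 * ‖N‖) * η ^ 4 := by ring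
  have hsplit : B - (A + (η ^ 2 * c) • (A * N * A)) =
      (B - η ^ 2 • 1) - (A - η ^ 2 • 1) - (η ^ 2 * c) • (A * N * A) := by abel
  rw [hsplit]
  have h1 := norm_sub_le ((B - η ^ 2 • 1) - (A - η ^ 2 • 1)) ((η ^ 2 * c) • (A * N * A))
  have h2 := norm_sub_le (B - η ^ 2 • 1) (A - η ^ 2 • 1)
  have h4 : 0 ≤ η ^ 4 := by positivity
  linarith

theorem stmt_0 (d k : ℕ) (hd : 1 ≤ d) (hk1 : 1 ≤ k) (hkd : k ≤ d)
    (P : Matrix (Fin k) (Fin d) ℝ) (hP : P * Pᵀ = 1)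
    (M : Matrix (Fin d) (Fin d) ℝ) (hM : M = Pᵀ * P)
    (S : Matrix (Fin d) (Fin d) ℝ) (hS : S.PosSemidef)
    (αs σs σy : ℝ) (hαs : 0 < αs) (hσs : 0 < σs) (hσy : 0 < σy)
    (D R Kdps Kding : Matrix (Fin d) (Fin d) ℝ)
    (hD : D = αs • S * (αs ^ 2 • S + σs ^ 2 • 1)⁻¹)
    (hR : R = 1 - αs • D)
    (hKdps : Kdps = (σy ^ 2)⁻¹ • (Dᵀ * M * D))
    (hKding : Kding = ((αs ^ 2)⁻¹ * (σy ^ 2)⁻¹) • M)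
    (Sdps Sding A : ℝ → Matrix (Fin d) (Fin d) ℝ)
    (hSdps : ∀ η : ℝ, 0 < η → Sdps η = ((η ^ 2)⁻¹ • 1 + Kdps)⁻¹)
    (hA : ∀ η : ℝ, 0 < η → A η = ((η ^ 2)⁻¹ • 1 + Kding)⁻¹)
    (hSding : ∀ η : ℝ, 0 < η → Sding η
      = A η + (η ^ 2 * (αs ^ 4)⁻¹ * (σy ^ 4)⁻¹) • (A η * M * R * Rᵀ * M * A η)) :
    ∃ C > (0 : ℝ), ∃ η₀ > (0 : ℝ), ∀ η : ℝ, 0 < η → η < η₀ →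
      IsUnit ((η ^ 2)⁻¹ • (1 : Matrix (Fin d) (Fin d) ℝ) + Kdps) ∧
      IsUnit ((η ^ 2)⁻¹ • (1 : Matrix (Fin d) (Fin d) ℝ) + Kding) ∧
      opNorm (Sdps η - Sding η) ≤ C * η ^ 4 := by
  obtain ⟨C, hC, η₀, hη₀, h⟩ := exists_opNorm_inv_sub_le Kdps Kding (M * R * Rᵀ * M)
    (c := (αs ^ 4)⁻¹ * (σy ^ 4)⁻¹) (by positivity)
  refine ⟨C, hC, η₀, hη₀, fun η hη hlt => ?_⟩
  rw [hSding η hη, hSdps η hη, hA η hη]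
  simpa only [Matrix.mul_assoc, mul_assoc] using h η hη hlt
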